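/- Let k be a field, Ω and X sets, and let R = k[W(Ω) × X] be the multivariate polynomial algebra on W(Ω) × X, where W(Ω) is the free monoid on Ω, equipped with the derivations D_ω determined by D_ω(X_{(w,x)}) = X_{(ω·w, x)}. Let P ⊆ R be the smallest k-submodule containing the generators X_{(1,x)} (x ∈ X, 1 the empty word) and closed under the operations a ∗_ω b := a · D_ω(b) for all ω ∈ Ω. Then P, together with the operations ∗_ω, is the free noncommuting multi-Novikov algebra on X: for every k-module N equipped with k-bilinear products (▷_ω)_{ω∈Ω} satisfying, for all x, y, z ∈ N and ω, τ ∈ Ω, (x ▷_ω y) ▷_τ z − x ▷_ω (y ▷_τ z) = (y ▷_ω x) ▷_τ z − y ▷_ω (x ▷_τ z) and (x ▷_ω y) ▷_τ z = (x ▷_τ z) ▷_ω y, and for every map f : X → N, there exists a unique k-linear map F : P → N such that F(X_{(1,x)}) = f(x) for all x ∈ X and F(a ∗_ω b) = F(a) ▷_ω F(b) for all a, b ∈ P and ω ∈ Ω. -/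

import Mathlib

/-- The derivation `D_ω` on `k[W(Ω) × X]` determined by `D_ω X_{(w,x)} = X_{(ω·w, x)}`,
where `W(Ω)` is the free monoid on `Ω`. -/
noncomputable def novikovDeriv (k : Type*) [Field k] {Ω X : Type*} (ω : Ω) :
    Derivation k (MvPolynomial (FreeMonoid Ω × X) k) (MvPolynomial (FreeMonoid Ω × X) k) :=
  MvPolynomial.mkDerivation k fun p => MvPolynomial.X (FreeMonoid.of ω * p.1, p.2)

/-- The smallest `k`-submodule of `k[W(Ω) × X]` containing the generators `X_{(1,x)}` and
closed under all the operations `(a, b) ↦ a · D_ω(b)`: the noncommuting multi-Novikov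
subalgebra generated by `X`. -/
noncomputable def novikovSubmodule (k : Type*) [Field k] (Ω X : Type*) :
    Submodule k (MvPolynomial (FreeMonoid Ω × X) k) :=
  sInf {N | (∀ x : X, MvPolynomial.X (1, x) ∈ N) ∧
    ∀ (ω : Ω) (a b : MvPolynomial (FreeMonoid Ω × X) k),
      a ∈ N → b ∈ N → a * novikovDeriv k ω b ∈ N}

theorem X_mem_novikovSubmodule (k : Type*) [Field k] (Ω X : Type*) (x : X) :
    MvPolynomial.X (1, x) ∈ novikovSubmodule k Ω X :=
  Submodule.mem_sInf.2 fun _ hN => hN.1 x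

namespace MultiNovikov

theorem exists_card_eq_add {α : Type*} {u : Multiset α} {n : ℕ} (h : n ≤ u.card) :
    ∃ v w, u = v + w ∧ v.card = n := by
  refine ⟨(u.toList.take n : List α), (u.toList.drop n : List α), ?_, by simpa using h⟩
  rw [Multiset.coe_add, List.take_append_drop, Multiset.coe_toList]

section EraseSum

variable {α β M M' : Type*} [AddCommMonoid M] [AddCommMonoid M']

open Classical in
/-- The sum of `g b t` over all ways (with multiplicity) of writing `u = b ::ₘ t`. -/
noncomputable def eraseSum (g : α → Multiset α → M) (u : Multiset α) : M :=
  (u.map fun b => g b (u.erase b)).sum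

@[simp]
theorem eraseSum_zero (g : α → Multiset α → M) : eraseSum g 0 = 0 := by
  simp [eraseSum]

theorem eraseSum_congr {g g' : α → Multiset α → M} {u : Multiset α}
    (h : ∀ b t, u = b ::ₘ t → g b t = g' b t) : eraseSum g u = eraseSum g' u := by
  classical
  unfold eraseSum
  exact congrArg _ (Multiset.map_congr rfl fun b hb => h _ _ (Multiset.cons_erase hb).symm)

theorem eraseSum_cons (g : α → Multiset α → M) (a : α) (u : Multiset α) :
    eraseSum g (a ::ₘ u) = g a u + eraseSum (fun b t => g b (a ::ₘ t)) u := by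
  classical
  unfold eraseSum
  rw [Multiset.map_cons, Multiset.sum_cons, Multiset.erase_cons_head]
  exact congrArg _ (congrArg _ (Multiset.map_congr rfl fun b hb => by
    rw [Multiset.erase_cons_tail_of_mem hb]))

theorem eraseSum_add (g : α → Multiset α → M) (u v : Multiset α) :
    eraseSum g (u + v)
      = eraseSum (fun b t => g b (t + v)) u + eraseSum (fun b t => g b (u + t)) v := by
  induction u using Multiset.induction generalizing g with
  | empty => simp
  | cons a u ih =>
    simp only [Multiset.cons_add, eraseSum_cons, ih, add_assoc]

theorem eraseSum_map (g : α → Multiset α → M) (h : β → α) (u : Multiset β) :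
    eraseSum g (u.map h) = eraseSum (fun b t => g (h b) (t.map h)) u := by
  induction u using Multiset.induction generalizing g with
  | empty => simp
  | cons a u ih => simp only [Multiset.map_cons, eraseSum_cons, ih]

theorem map_eraseSum (F : M →+ M') (g : α → Multiset α → M) (u : Multiset α) :
    F (eraseSum g u) = eraseSum (fun b t => F (g b t)) u := by
  simp [eraseSum, map_multiset_sum, Multiset.map_map]

theorem eraseSum_mem {T : Type*} [SetLike T M] [AddSubmonoidClass T M] {P : T}
    {g : α → Multiset α → M} {u : Multiset α} (h : ∀ b t, u = b ::ₘ t → g b t ∈ P) :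
    eraseSum g u ∈ P := by
  classical
  refine multiset_sum_mem _ fun p hp => ?_
  obtain ⟨b, hb, rfl⟩ := Multiset.mem_map.1 hp
  exact h _ _ (Multiset.cons_erase hb).symm

end EraseSum

/-- A homogeneous cochain of degree `n`: a function `c` on multisets of elements of `N` with
values in `S`, supported on multisets of cardinality `n`, such that `c(b₁, …, bₙ) • b₀` is
symmetric in `b₀, …, bₙ`. -/
@[ext]
structure Cochain (S N : Type*) [CommRing S] [AddCommGroup N] [Module S N] where
  /-- The degree of the cochain. -/
  deg : ℕ
  /-- The values of the cochain. -/
  val : Multiset N → S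
  val_cons_smul : ∀ a b u, val (a ::ₘ u) • b = val (b ::ₘ u) • a
  val_of_card_ne : ∀ u, u.card ≠ deg → val u = 0

namespace Cochain

variable {S N : Type*} [CommRing S] [AddCommGroup N] [Module S N]

open Classical in
/-- The symmetric function `(b₀, …, bₙ) ↦ c(b₁, …, bₙ) • b₀` attached to a cochain `c`. -/
noncomputable def eval (φ : Cochain S N) (u : Multiset N) : N :=
  if h : ∃ a, a ∈ u then φ.val (u.erase h.choose) • h.choose else 0

@[simp]
theorem eval_zero (φ : Cochain S N) : φ.eval 0 = 0 := by
  simp [eval]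

@[simp]
theorem eval_cons (φ : Cochain S N) (a : N) (u : Multiset N) :
    φ.eval (a ::ₘ u) = φ.val u • a := by
  classical
  have h : ∃ b, b ∈ a ::ₘ u := ⟨a, Multiset.mem_cons_self a u⟩
  have hb := h.choose_spec
  rw [eval, dif_pos h]
  generalize h.choose = b at hb ⊢
  by_cases hab : b = a
  · subst hab
    simp
  · obtain ⟨v, rfl⟩ := Multiset.exists_cons_of_mem ((Multiset.mem_cons.1 hb).resolve_left hab)
    rw [Multiset.cons_swap, Multiset.erase_cons_head, φ.val_cons_smul]

/-- The cochain of degree `0` given by a scalar. -/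
noncomputable def const (s : S) : Cochain S N where
  deg := 0
  val u := if u.card = 0 then s else 0
  val_cons_smul a b u := by simp
  val_of_card_ne u h := if_neg h

@[simp]
theorem const_deg (s : S) : (const s : Cochain S N).deg = 0 := rfl

@[simp]
theorem const_val_zero (s : S) : (const s : Cochain S N).val 0 = s := by simp [const]

noncomputable instance : One (Cochain S N) := ⟨const 1⟩

@[simp]
theorem one_deg : (1 : Cochain S N).deg = 0 := rfl

@[simp]
theorem one_val_zero : (1 : Cochain S N).val 0 = 1 := const_val_zero 1

protected theorem ext_of_card {φ ψ : Cochain S N} (hd : φ.deg = ψ.deg)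
    (h : ∀ u, u.card = φ.deg → φ.val u = ψ.val u) : φ = ψ := by
  refine Cochain.ext hd (funext fun u => ?_)
  by_cases hu : u.card = φ.deg
  · exact h u hu
  · rw [φ.val_of_card_ne u hu, ψ.val_of_card_ne u (hd ▸ hu)]

section Mul

variable [FaithfulSMul S N]

theorem val_mul_val_exchange (φ ψ : Cochain S N) (a b : N) (u v : Multiset N) :
    φ.val (a ::ₘ u) * ψ.val (b ::ₘ v) = φ.val (b ::ₘ u) * ψ.val (a ::ₘ v) := by
  refine FaithfulSMul.eq_of_smul_eq_smul (α := N) fun c => ?_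
  rw [mul_smul, ψ.val_cons_smul b c, smul_comm, φ.val_cons_smul a b, smul_comm,
    ψ.val_cons_smul c a, mul_smul]

theorem val_mul_val_of_perm (φ ψ : Cochain S N) {l l' : List N} (h : l.Perm l') :
    ∀ (c : Multiset N) (n : ℕ),
      φ.val (c + (l.take n : List N)) * ψ.val (l.drop n : List N)
        = φ.val (c + (l'.take n : List N)) * ψ.val (l'.drop n : List N) := by
  induction h with
  | nil => simp
  | @cons a l₁ l₂ h ih =>
    rintro c (_ | n)
    · have : ((a :: l₁ : List N) : Multiset N) = (a :: l₂ : List N) :=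
        Multiset.coe_eq_coe.2 (h.cons a)
      simp [this]
    · simpa [← Multiset.cons_coe] using ih (a ::ₘ c) n
  | swap a b l =>
    rintro c (_ | _ | n)
    · have : ((b :: a :: l : List N) : Multiset N) = (a :: b :: l : List N) :=
        Multiset.coe_eq_coe.2 (List.Perm.swap a b l)
      simp [this]
    · simpa [← Multiset.cons_coe, add_comm c] using val_mul_val_exchange φ ψ b a c l
    · have : ((b :: a :: l.take n : List N) : Multiset N) = (a :: b :: l.take n : List N) :=
        Multiset.coe_eq_coe.2 (List.Perm.swap a b _)
      simp [this]
  | trans _ _ ih₁ ih₂ => exact fun c n => (ih₁ c n).trans (ih₂ c n)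

/-- The underlying function of the product of two cochains. -/
noncomputable def mulVal (φ ψ : Cochain S N) (u : Multiset N) : S :=
  if u.card = φ.deg + ψ.deg then
    φ.val (u.toList.take φ.deg : List N) * ψ.val (u.toList.drop φ.deg : List N)
  else 0

theorem mulVal_add (φ ψ : Cochain S N) {u : Multiset N} (hu : u.card = φ.deg) (v : Multiset N) :
    mulVal φ ψ (u + v) = φ.val u * ψ.val v := by
  unfold mulVal
  split_ifs with h
  · induction u using Quotient.inductionOn with | _ l₁
    induction v using Quotient.inductionOn with | _ l₂
    have hp : ((l₁ : Multiset N) + (l₂ : Multiset N)).toList.Perm (l₁ ++ l₂) := by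
      rw [← Multiset.coe_eq_coe, Multiset.coe_toList, Multiset.coe_add]
    have hl : l₁.length = φ.deg := by simpa using hu
    have := val_mul_val_of_perm φ ψ hp 0 φ.deg
    rw [zero_add, zero_add] at this
    simpa [← hl] using this
  · rw [ψ.val_of_card_ne v, mul_zero]
    rw [Multiset.card_add] at h
    lia

noncomputable instance : Mul (Cochain S N) where
  mul φ ψ :=
    { deg := φ.deg + ψ.deg
      val := mulVal φ ψ
      val_cons_smul := fun a b u => by
        by_cases hu : u.card + 1 = φ.deg + ψ.deg
        · rcases Nat.lt_or_ge u.card φ.deg with h | h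
          · have hψ : ψ.deg = 0 := by lia
            have key : ∀ c, mulVal φ ψ (c ::ₘ u) = φ.val (c ::ₘ u) * ψ.val 0 := fun c => by
              rw [← mulVal_add φ ψ (by simp; lia), add_zero]
            rw [key, key, mul_comm, mul_smul, φ.val_cons_smul, ← mul_smul, mul_comm]
          · obtain ⟨v, w, rfl, hv⟩ := exists_card_eq_add h
            rw [← Multiset.add_cons, ← Multiset.add_cons, mulVal_add φ ψ hv, mulVal_add φ ψ hv,
              mul_smul, ψ.val_cons_smul, mul_smul]
        · rw [mulVal, if_neg (by simpa using hu), mulVal, if_neg (by simpa using hu), zero_smul,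
            zero_smul]
      val_of_card_ne := fun u h => if_neg h }

@[simp]
theorem mul_deg (φ ψ : Cochain S N) : (φ * ψ).deg = φ.deg + ψ.deg := rfl

theorem mul_val_add (φ ψ : Cochain S N) {u : Multiset N} (hu : u.card = φ.deg)
    (v : Multiset N) : (φ * ψ).val (u + v) = φ.val u * ψ.val v :=
  mulVal_add φ ψ hu v

theorem const_mul_val (s : S) (φ : Cochain S N) (u : Multiset N) :
    (const s * φ).val u = s * φ.val u := by
  simpa using mul_val_add (const s) φ (u := 0) rfl u

noncomputable instance : CommMonoid (Cochain S N) where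
  mul_comm φ ψ := by
    refine Cochain.ext_of_card (add_comm _ _) fun u hu => ?_
    obtain ⟨v, w, rfl, hv⟩ := exists_card_eq_add (n := φ.deg) (by rw [hu]; simp)
    have hw : w.card = ψ.deg := by
      rw [Multiset.card_add, hv, mul_deg] at hu
      lia
    rw [mul_val_add φ ψ hv, add_comm v, mul_val_add ψ φ hw, mul_comm]
  one_mul φ := by
    refine Cochain.ext_of_card (zero_add _) fun u _ => ?_
    exact (const_mul_val 1 φ u).trans (one_mul _)
  mul_one φ := by
    refine Cochain.ext_of_card (add_zero _) fun u hu => ?_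
    have := mul_val_add φ 1 (u := u) (by simpa using hu) 0
    simpa using this
  mul_assoc φ ψ χ := by
    refine Cochain.ext_of_card (add_assoc _ _ _) fun u hu => ?_
    simp only [mul_deg] at hu
    obtain ⟨v, w, rfl, hv⟩ := exists_card_eq_add (u := u) (n := φ.deg) (by lia)
    rw [Multiset.card_add] at hu
    obtain ⟨w, z, rfl, hw⟩ := exists_card_eq_add (u := w) (n := ψ.deg) (by lia)
    rw [mul_val_add _ _ hv, mul_val_add _ _ hw, ← add_assoc, mul_val_add _ _ (by simp [hv, hw]),
      mul_val_add _ _ hv, mul_assoc]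

end Mul

section Deriv

/-- The property of a family of scalars `R b`, to be thought of as `D b`, that makes
`a · b · D T := a · D (T • b) - a · T • D b` symmetric in `a` and `b`. -/
def IsSymmetric (R : N → S) : Prop :=
  ∀ (T : S) (a b : N), (R (T • b) - R b * T) • a = (R (T • a) - R a * T) • b

variable [FaithfulSMul S N] {R : N → S}

theorem IsSymmetric.map_zero (hR : IsSymmetric R) : R 0 = 0 := by
  refine FaithfulSMul.eq_of_smul_eq_smul (α := N) fun c => ?_
  simpa using hR 0 c 0

theorem IsSymmetric.map_mul_smul (hR : IsSymmetric R) (T U : S) (b : N) :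
    R ((T * U) • b) - R b * (T * U)
      = (R (T • b) - R b * T) * U + T * (R (U • b) - R b * U) := by
  have h : R (T • U • b) - R (U • b) * T = (R (T • b) - R b * T) * U := by
    refine FaithfulSMul.eq_of_smul_eq_smul (α := N) fun a => ?_
    rw [hR T a (U • b), smul_comm, hR T b a, mul_comm _ U, mul_smul]
  rw [← h, mul_smul]
  ring

/-- The derivative of a cochain. -/
noncomputable def deriv (hR : IsSymmetric R) (φ : Cochain S N) : Cochain S N where
  deg := φ.deg + 1
  val u := R (φ.eval u) - eraseSum (fun b t => R b * φ.val t) u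
  val_cons_smul a b u := by
    have hs : ∀ c d : N, eraseSum (fun b t => R b * φ.val (c ::ₘ t)) u • d
        = eraseSum (fun b t => R b • φ.val (c ::ₘ t) • d) u := fun c d => by
      simpa [mul_smul] using map_eraseSum ((smulAddHom S N).flip d)
        (fun b t => R b * φ.val (c ::ₘ t)) u
    simp only [eraseSum_cons, eval_cons]
    rw [← sub_sub, ← sub_sub, sub_smul, sub_smul _ _ a, hR, hs, hs]
    congr 2
    funext c t
    rw [φ.val_cons_smul]
  val_of_card_ne u hu := by
    have h₁ : φ.eval u = 0 := by
      induction u using Multiset.induction with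
      | empty => simp
      | cons a u _ =>
        rw [eval_cons, φ.val_of_card_ne u, zero_smul]
        simpa using hu
    have h₂ : eraseSum (fun b t => R b * φ.val t) u = eraseSum (fun _ _ => 0) u :=
      eraseSum_congr fun b t h => by
        subst h
        rw [φ.val_of_card_ne t, mul_zero]
        simpa using hu
    rw [h₁, h₂, hR.map_zero]
    simp [eraseSum]

@[simp]
theorem deriv_deg (hR : IsSymmetric R) (φ : Cochain S N) : (φ.deriv hR).deg = φ.deg + 1 := rfl

theorem deriv_val (hR : IsSymmetric R) (φ : Cochain S N) (u : Multiset N) :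
    (φ.deriv hR).val u = R (φ.eval u) - eraseSum (fun b t => R b * φ.val t) u := rfl

theorem deriv_one (hR : IsSymmetric R) (u : Multiset N) :
    ((1 : Cochain S N).deriv hR).val u = 0 := by
  by_cases hu : u.card = 1
  · obtain ⟨a, rfl⟩ := Multiset.card_eq_one.1 hu
    rw [← Multiset.cons_zero, deriv_val, eraseSum_cons, eval_cons]
    simp
  · exact val_of_card_ne _ _ hu

theorem deriv_mul (hR : IsSymmetric R) (φ ψ : Cochain S N) (u : Multiset N) :
    ((φ * ψ).deriv hR).val u = (φ.deriv hR * ψ).val u + (φ * ψ.deriv hR).val u := by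
  by_cases hu : u.card = φ.deg + ψ.deg + 1
  · obtain ⟨v, w, rfl, hv⟩ := exists_card_eq_add (u := u) (n := φ.deg) (by lia)
    rw [Multiset.card_add] at hu
    obtain ⟨y, w, rfl⟩ : ∃ y t, w = y ::ₘ t := by
      obtain ⟨y, hy⟩ := Multiset.card_pos_iff_exists_mem.1 (show 0 < w.card by lia)
      exact ⟨y, Multiset.exists_cons_of_mem hy⟩
    have h₁ : (φ.deriv hR * ψ).val (v + y ::ₘ w) = (φ.deriv hR).val (y ::ₘ v) * ψ.val w := by
      rw [Multiset.add_cons, ← Multiset.cons_add, mul_val_add _ _ (by simp [hv])]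
    have h₂ : eraseSum (fun b t => R b * (φ * ψ).val (y ::ₘ (t + w))) v
        = eraseSum (fun b t => R b * φ.val (y ::ₘ t)) v * ψ.val w := by
      refine Eq.trans (eraseSum_congr fun b t h => ?_)
        (map_eraseSum (AddMonoidHom.mulRight (ψ.val w)) _ v).symm
      subst h
      rw [← Multiset.cons_add, mul_val_add _ _ (by simpa using hv)]
      simp [mul_assoc]
    have h₃ : eraseSum (fun b t => R b * (φ * ψ).val (y ::ₘ (v + t))) w
        = φ.val v * eraseSum (fun b t => R b * ψ.val (y ::ₘ t)) w := by
      refine Eq.trans (eraseSum_congr fun b t h => ?_)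
        (map_eraseSum (AddMonoidHom.mulLeft (φ.val v)) _ w).symm
      rw [← Multiset.add_cons, mul_val_add _ _ hv]
      simp [mul_left_comm]
    rw [h₁, mul_val_add _ _ hv, deriv_val, deriv_val, deriv_val, Multiset.add_cons, eval_cons,
      eval_cons, eval_cons, eraseSum_cons, eraseSum_cons, eraseSum_cons, eraseSum_add,
      mul_val_add _ _ hv, h₂, h₃]
    linear_combination hR.map_mul_smul (φ.val v) (ψ.val w) y
  · rw [val_of_card_ne _ _ hu, val_of_card_ne _ _ (by simp; lia),
      val_of_card_ne _ _ (by simp; lia), add_zero]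

theorem deriv_prod_map {σ : Type*} (hR : IsSymmetric R) (c : σ → Cochain S N)
    (s : Multiset σ) (u : Multiset N) :
    ((s.map c).prod.deriv hR).val u
      = eraseSum (fun v t => ((c v).deriv hR * (t.map c).prod).val u) s := by
  induction s using Multiset.induction generalizing u with
  | empty => simp [deriv_one]
  | cons v s ih =>
    rw [Multiset.map_cons, Multiset.prod_cons, deriv_mul, eraseSum_cons]
    congr 1
    simp only [Multiset.map_cons, Multiset.prod_cons, mul_left_comm _ (c v)]
    rcases Nat.lt_or_ge u.card (c v).deg with h | h
    · rw [val_of_card_ne _ _ (by simp; lia), eraseSum_congr (g' := fun _ _ => 0)]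
      · simp [eraseSum]
      · exact fun _ _ _ => val_of_card_ne _ _ (by simp; lia)
    · obtain ⟨a, b, rfl, ha⟩ := exists_card_eq_add h
      simp only [mul_val_add _ _ ha, ih]
      exact map_eraseSum (AddMonoidHom.mulLeft ((c v).val a)) _ s

end Deriv

end Cochain

section Roots

variable {Ω X N : Type*}

open Classical in
/-- The values of the variables with empty word of a monomial. -/
noncomputable def roots (f : X → N) (s : Multiset (FreeMonoid Ω × X)) : Multiset N :=
  (s.map fun v => if v.1 = 1 then {f v.2} else 0).sum

theorem roots_cons_of_ne (f : X → N) (v : FreeMonoid Ω × X) (hv : v.1 ≠ 1)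
    (s : Multiset (FreeMonoid Ω × X)) : roots f (v ::ₘ s) = roots f s := by
  simp [roots, hv]

theorem roots_cons_one (f : X → N) (x : X) (s : Multiset (FreeMonoid Ω × X)) :
    roots f ((1, x) ::ₘ s) = f x ::ₘ roots f s := by
  simp [roots]

theorem roots_add (f : X → N) (s t : Multiset (FreeMonoid Ω × X)) :
    roots f (s + t) = roots f s + roots f t := by
  simp [roots]

theorem roots_map_one (f : X → N) (u : Multiset X) :
    roots f (u.map fun x => ((1 : FreeMonoid Ω), x)) = u.map f := by
  induction u using Multiset.induction with
  | empty => simp [roots]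
  | cons x u ih => rw [Multiset.map_cons, roots_cons_one, ih, Multiset.map_cons]

theorem roots_of_ne_one (f : X → N) (s : Multiset (FreeMonoid Ω × X)) (hs : ∀ v ∈ s, v.1 ≠ 1) :
    roots f s = 0 := by
  induction s using Multiset.induction with
  | empty => simp [roots]
  | cons v s ih =>
    rw [roots_cons_of_ne f v (hs v (Multiset.mem_cons_self v s)),
      ih fun v hv => hs v (Multiset.mem_cons_of_mem hv)]

theorem exists_eq_map_one_add (s : Multiset (FreeMonoid Ω × X)) :
    ∃ (u : Multiset X) (t : Multiset (FreeMonoid Ω × X)),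
      s = u.map (fun x => ((1 : FreeMonoid Ω), x)) + t ∧ ∀ v ∈ t, v.1 ≠ 1 := by
  induction s using Multiset.induction with
  | empty => exact ⟨0, 0, by simp⟩
  | cons v s ih =>
    obtain ⟨u, t, rfl, ht⟩ := ih
    by_cases hv : v.1 = 1
    · refine ⟨v.2 ::ₘ u, t, ?_, ht⟩
      rw [Multiset.map_cons, Multiset.cons_add, ← hv]
    · refine ⟨u, v ::ₘ t, (Multiset.add_cons _ _ _).symm, fun z hz => ?_⟩
      rcases Multiset.mem_cons.1 hz with rfl | h
      · exact hv
      · exact ht z h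

/-- The action of `D_ω` on variables. -/
def shift (ω : Ω) (v : FreeMonoid Ω × X) : FreeMonoid Ω × X := (FreeMonoid.of ω * v.1, v.2)

theorem shift_fst_ne_one (ω : Ω) (v : FreeMonoid Ω × X) : (shift ω v).1 ≠ 1 :=
  fun h => List.cons_ne_nil ω v.1.toList h

end Roots

section Words

open Cochain

variable {Ω X S N : Type*} [CommRing S] [AddCommGroup N] [Module S N] [FaithfulSMul S N]
  {R : Ω → N → S}

/-- The cochain attached to the variable `(w, x)`; a variable with empty word is sent to `1`,
being recorded by `roots` instead. -/
noncomputable def wordCochain (hR : ∀ ω, IsSymmetric (R ω)) (n : N) : List Ω → Cochain S N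
  | [] => 1
  | [ω] => const (R ω n)
  | ω :: τ :: w => (wordCochain hR n (τ :: w)).deriv (hR ω)

/-- The product of the cochains attached to the variables of a monomial. -/
noncomputable def cochain (hR : ∀ ω, IsSymmetric (R ω)) (f : X → N)
    (s : Multiset (FreeMonoid Ω × X)) : Cochain S N :=
  (s.map fun v => wordCochain hR (f v.2) v.1.toList).prod

theorem wordCochain_shift_one (hR : ∀ ω, IsSymmetric (R ω)) (n : N) (ω : Ω) (x : X) :
    wordCochain hR n (shift ω ((1 : FreeMonoid Ω), x)).1.toList = const (R ω n) := rfl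

theorem wordCochain_shift (hR : ∀ ω, IsSymmetric (R ω)) (n : N) (ω : Ω) (v : FreeMonoid Ω × X)
    (hv : v.1 ≠ 1) : wordCochain hR n (shift ω v).1.toList
      = (wordCochain hR n v.1.toList).deriv (hR ω) := by
  obtain ⟨w, x⟩ := v
  rcases w with _ | ⟨τ, w⟩
  · exact absurd rfl hv
  · rfl

theorem cochain_cons (hR : ∀ ω, IsSymmetric (R ω)) (f : X → N) (v : FreeMonoid Ω × X)
    (s : Multiset (FreeMonoid Ω × X)) :
    cochain hR f (v ::ₘ s) = wordCochain hR (f v.2) v.1.toList * cochain hR f s := by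
  simp [cochain]

theorem cochain_add (hR : ∀ ω, IsSymmetric (R ω)) (f : X → N)
    (s t : Multiset (FreeMonoid Ω × X)) :
    cochain hR f (s + t) = cochain hR f s * cochain hR f t := by
  simp [cochain]

theorem cochain_map_one (hR : ∀ ω, IsSymmetric (R ω)) (f : X → N) (u : Multiset X) :
    cochain hR f (u.map fun x => ((1 : FreeMonoid Ω), x)) = 1 := by
  refine Multiset.prod_eq_one fun c hc => ?_
  obtain ⟨v, hv, rfl⟩ := Multiset.mem_map.1 hc
  obtain ⟨x, -, rfl⟩ := Multiset.mem_map.1 hv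
  rfl

/-- The value in `N` of a monomial of weight `-1`. -/
noncomputable def monomialValue (hR : ∀ ω, IsSymmetric (R ω)) (f : X → N)
    (s : Multiset (FreeMonoid Ω × X)) : N :=
  (cochain hR f s).eval (roots f s)

/-- The scalar by which a monomial of weight `0` acts on `N`. -/
noncomputable def monomialScalar (hR : ∀ ω, IsSymmetric (R ω)) (f : X → N)
    (s : Multiset (FreeMonoid Ω × X)) : S :=
  (cochain hR f s).val (roots f s)

/-- The monomials of weight `-1`, where `X_{(w,x)}` has weight `|w| - 1`. -/
def HasWeightNegOne (hR : ∀ ω, IsSymmetric (R ω)) (f : X → N)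
    (s : Multiset (FreeMonoid Ω × X)) : Prop :=
  (roots f s).card = (cochain hR f s).deg + 1

theorem hasWeightNegOne_singleton (hR : ∀ ω, IsSymmetric (R ω)) (f : X → N) (x : X) :
    HasWeightNegOne hR f {(1, x)} := by
  simp [HasWeightNegOne, roots, cochain, wordCochain]

theorem monomialValue_singleton (hR : ∀ ω, IsSymmetric (R ω)) (f : X → N) (x : X) :
    monomialValue hR f {(1, x)} = f x := by
  have := eval_cons (1 : Cochain S N) (f x) 0
  simpa [monomialValue, roots, cochain, wordCochain] using this

theorem monomialValue_add (hR : ∀ ω, IsSymmetric (R ω)) (f : X → N)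
    {s : Multiset (FreeMonoid Ω × X)} (hs : HasWeightNegOne hR f s)
    (t : Multiset (FreeMonoid Ω × X)) :
    monomialValue hR f (s + t) = monomialScalar hR f t • monomialValue hR f s := by
  unfold HasWeightNegOne at hs
  unfold monomialValue monomialScalar
  rw [roots_add, cochain_add]
  obtain ⟨y, hy⟩ := Multiset.card_pos_iff_exists_mem.1 (show 0 < (roots f s).card by lia)
  obtain ⟨u, hu⟩ := Multiset.exists_cons_of_mem hy
  rw [hu, Multiset.card_cons, Nat.add_right_cancel_iff] at hs
  rw [hu, Multiset.cons_add, eval_cons, eval_cons, mul_val_add _ _ hs, mul_comm, mul_smul]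

theorem HasWeightNegOne.add_shift {hR : ∀ ω, IsSymmetric (R ω)} {f : X → N}
    {s t : Multiset (FreeMonoid Ω × X)} {v : FreeMonoid Ω × X} (hs : HasWeightNegOne hR f s)
    (ht : HasWeightNegOne hR f (v ::ₘ t)) (ω : Ω) :
    HasWeightNegOne hR f (s + shift ω v ::ₘ t) := by
  obtain ⟨w, x⟩ := v
  unfold HasWeightNegOne at hs ht ⊢
  rw [roots_add, cochain_add, roots_cons_of_ne _ _ (shift_fst_ne_one ω _), cochain_cons,
    Multiset.card_add, hs, mul_deg, mul_deg]
  rw [cochain_cons, mul_deg] at ht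
  by_cases hw : w = 1
  · subst hw
    rw [roots_cons_one, Multiset.card_cons] at ht
    rw [wordCochain_shift_one, const_deg]
    have : (wordCochain hR (f x) (1 : FreeMonoid Ω).toList).deg = 0 := rfl
    lia
  · rw [roots_cons_of_ne _ _ hw] at ht
    rw [wordCochain_shift _ _ _ _ hw, deriv_deg]
    simp only [shift]
    lia

theorem eraseSum_monomialScalar_shift (hR : ∀ ω, IsSymmetric (R ω)) (f : X → N) (ω : Ω)
    (s : Multiset (FreeMonoid Ω × X)) :
    eraseSum (fun v t => monomialScalar hR f (shift ω v ::ₘ t)) s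
      = R ω (monomialValue hR f s) := by
  obtain ⟨u, s, rfl, hs⟩ := exists_eq_map_one_add s
  have hroots : eraseSum (fun x t => monomialScalar hR f
        (shift ω (1, x) ::ₘ (t.map (fun x => ((1 : FreeMonoid Ω), x)) + s))) u
      = eraseSum (fun b t => R ω b * (cochain hR f s).val t) (u.map f) := by
    rw [eraseSum_map]
    refine eraseSum_congr fun x t _ => ?_
    rw [monomialScalar, roots_cons_of_ne _ _ (shift_fst_ne_one ω _), roots_add, roots_map_one,
      roots_of_ne_one f s hs, add_zero, cochain_cons, wordCochain_shift_one, const_mul_val,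
      cochain_add, cochain_map_one, one_mul]
    rfl
  have hrest : eraseSum (fun v t => monomialScalar hR f
        (shift ω v ::ₘ (u.map (fun x => ((1 : FreeMonoid Ω), x)) + t))) s
      = ((cochain hR f s).deriv (hR ω)).val (u.map f) := by
    rw [cochain, deriv_prod_map]
    refine eraseSum_congr fun v t ht => ?_
    subst ht
    rw [monomialScalar, roots_cons_of_ne _ _ (shift_fst_ne_one ω _), roots_add, roots_map_one,
      roots_of_ne_one f t fun v hv => hs v (Multiset.mem_cons_of_mem hv), add_zero, cochain_cons,
      wordCochain_shift _ _ _ _ (hs v (Multiset.mem_cons_self v t)), cochain_add,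
      cochain_map_one, one_mul]
    rfl
  rw [eraseSum_add, eraseSum_map]
  rw [hroots, hrest, deriv_val, monomialValue, roots_add, roots_map_one,
    roots_of_ne_one f s hs, add_zero, cochain_add, cochain_map_one, one_mul]
  abel

end Words

section Polynomials

open Cochain

variable {k : Type*} [Field k] {Ω X : Type*}

theorem novikovDeriv_prod_map_X (ω : Ω) (s : Multiset (FreeMonoid Ω × X)) :
    novikovDeriv k ω (s.map MvPolynomial.X).prod
      = eraseSum (fun v t => (((shift ω v ::ₘ t).map MvPolynomial.X).prod : MvPolynomial _ k)) s := by
  induction s using Multiset.induction with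
  | empty => simp
  | cons v s ih =>
    rw [Multiset.map_cons, Multiset.prod_cons, Derivation.leibniz, ih, eraseSum_cons, add_comm]
    congr 1
    · simp [novikovDeriv, shift, mul_comm]
    · refine (map_eraseSum (AddMonoidHom.mulLeft (MvPolynomial.X v : MvPolynomial _ k)) _ s).trans ?_
      simp [mul_left_comm]

variable {S N : Type*} [CommRing S] [AddCommGroup N] [Module S N] [FaithfulSMul S N]
  [Module k N] {R : Ω → N → S}

/-- The linear map extending `monomialValue`. -/
noncomputable def polynomialValue (k : Type*) [Field k] [Module k N]
    (hR : ∀ ω, IsSymmetric (R ω)) (f : X → N) :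
    MvPolynomial (FreeMonoid Ω × X) k →ₗ[k] N :=
  (MvPolynomial.basisMonomials _ k).constr k fun m => monomialValue hR f (Finsupp.toMultiset m)

theorem polynomialValue_prod_map_X (hR : ∀ ω, IsSymmetric (R ω)) (f : X → N)
    (s : Multiset (FreeMonoid Ω × X)) :
    polynomialValue k hR f (s.map MvPolynomial.X).prod = monomialValue hR f s := by
  classical
  have h : ((s.map MvPolynomial.X).prod : MvPolynomial _ k) = MvPolynomial.basisMonomials _ k (Multiset.toFinsupp s) := by
    rw [MvPolynomial.coe_basisMonomials]
    induction s using Multiset.induction with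
    | empty => simp
    | cons v s ih =>
      rw [Multiset.map_cons, Multiset.prod_cons, ih, MvPolynomial.X, MvPolynomial.monomial_mul, ← Multiset.singleton_add,
        map_add, Multiset.toFinsupp_singleton, one_mul]
  rw [h, polynomialValue, Module.Basis.constr_basis, Multiset.toFinsupp_toMultiset]

/-- The span of the monomials of weight `-1`. -/
noncomputable def weightNegOne (k : Type*) [Field k] (hR : ∀ ω, IsSymmetric (R ω)) (f : X → N) :
    Submodule k (MvPolynomial (FreeMonoid Ω × X) k) :=
  Submodule.span k ((fun s => (s.map MvPolynomial.X).prod) '' {s | HasWeightNegOne hR f s})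

theorem weightNegOne_mul_novikovDeriv (hR : ∀ ω, IsSymmetric (R ω)) (f : X → N)
    (rhd : Ω → N →ₗ[k] N →ₗ[k] N) (hrhd : ∀ ω x y, rhd ω x y = R ω y • x) (ω : Ω)
    {a b : MvPolynomial (FreeMonoid Ω × X) k}
    (ha : a ∈ weightNegOne k hR f) (hb : b ∈ weightNegOne k hR f) :
    a * novikovDeriv k ω b ∈ weightNegOne k hR f ∧
      polynomialValue k hR f (a * novikovDeriv k ω b)
        = rhd ω (polynomialValue k hR f a) (polynomialValue k hR f b) := by
  induction ha using Submodule.span_induction with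
  | zero => simp
  | add a a' _ _ h h' =>
    rw [add_mul]
    exact ⟨add_mem h.1 h'.1, by simp [h.2, h'.2]⟩
  | smul c a _ h =>
    rw [smul_mul_assoc]
    exact ⟨Submodule.smul_mem _ c h.1, by simp [h.2]⟩
  | mem a ha =>
    obtain ⟨s, hs, rfl⟩ := ha
    induction hb using Submodule.span_induction with
    | zero => simp
    | add b b' _ _ h h' =>
      rw [map_add, mul_add]
      exact ⟨add_mem h.1 h'.1, by simp [h.2, h'.2]⟩
    | smul c b _ h =>
      rw [Derivation.map_smul, mul_smul_comm]
      exact ⟨Submodule.smul_mem _ c h.1, by simp [h.2]⟩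
    | mem b hb =>
      obtain ⟨t, ht, rfl⟩ := hb
      have h : (s.map MvPolynomial.X).prod * novikovDeriv k ω (t.map MvPolynomial.X).prod
          = eraseSum (fun v r => (((s + shift ω v ::ₘ r).map MvPolynomial.X).prod : MvPolynomial _ k)) t := by
        rw [novikovDeriv_prod_map_X]
        refine (map_eraseSum (AddMonoidHom.mulLeft ((s.map MvPolynomial.X).prod : MvPolynomial _ k)) _ t).trans
          (eraseSum_congr fun v r _ => ?_)
        rw [Multiset.map_add, Multiset.prod_add]
        rfl
      simp only [h]
      constructor
      · refine eraseSum_mem fun v r hr => Submodule.subset_span ⟨_, hs.add_shift ?_ ω, rfl⟩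
        exact hr ▸ ht
      · rw [polynomialValue_prod_map_X, polynomialValue_prod_map_X, hrhd,
          ← eraseSum_monomialScalar_shift hR]
        refine (map_eraseSum (polynomialValue k hR f).toAddMonoidHom _ t).trans ?_
        refine Eq.trans ?_ (map_eraseSum ((smulAddHom S N).flip (monomialValue hR f s)) _ t).symm
        refine eraseSum_congr fun v r _ => ?_
        exact (polynomialValue_prod_map_X hR f _).trans (monomialValue_add hR f hs _)

theorem exists_linearMap_of_isSymmetric (hR : ∀ ω, IsSymmetric (R ω)) (f : X → N)
    (rhd : Ω → N →ₗ[k] N →ₗ[k] N) (hrhd : ∀ ω x y, rhd ω x y = R ω y • x) :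
    ∃ L : MvPolynomial (FreeMonoid Ω × X) k →ₗ[k] N, (∀ x, L (MvPolynomial.X (1, x)) = f x) ∧
      ∀ ω, ∀ a ∈ novikovSubmodule k Ω X, ∀ b ∈ novikovSubmodule k Ω X,
        L (a * novikovDeriv k ω b) = rhd ω (L a) (L b) := by
  have hle : novikovSubmodule k Ω X ≤ weightNegOne k hR f := by
    refine sInf_le ⟨fun x => Submodule.subset_span ⟨_, hasWeightNegOne_singleton hR f x, by simp⟩,
      fun ω a b ha hb => (weightNegOne_mul_novikovDeriv hR f rhd hrhd ω ha hb).1⟩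
  refine ⟨polynomialValue k hR f, fun x => ?_, fun ω a ha b hb =>
    (weightNegOne_mul_novikovDeriv hR f rhd hrhd ω (hle ha) (hle hb)).2⟩
  simpa [monomialValue_singleton] using polynomialValue_prod_map_X (k := k) hR f {(1, x)}

end Polynomials

section RightMultiplications

variable {k : Type*} [CommRing k] {Ω N : Type*} [AddCommGroup N] [Module k N]
  (rhd : Ω → N →ₗ[k] N →ₗ[k] N)

/-- The algebra of endomorphisms generated by the right multiplications. -/
def rightMulAlgebra : Subalgebra k (Module.End k N) :=
  Algebra.adjoin k (Set.range fun p : Ω × N => (rhd p.1).flip p.2)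

variable {rhd}

theorem rightMulAlgebra_apply_rhd
    (hN2 : ∀ ω τ x y z, rhd τ (rhd ω x y) z = rhd ω (rhd τ x z) y)
    {T : Module.End k N} (hT : T ∈ rightMulAlgebra rhd) (ω : Ω) (x y : N) :
    T (rhd ω x y) = rhd ω (T x) y := by
  induction hT using Algebra.adjoin_induction generalizing x with
  | mem T hT =>
    obtain ⟨⟨τ, z⟩, rfl⟩ := hT
    exact hN2 ω τ x y z
  | algebraMap c => simp
  | add T U _ _ hT hU => simp [hT, hU]
  | mul T U _ _ hT hU => simp [hT, hU]

theorem rightMulAlgebra_comm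
    (hN2 : ∀ ω τ x y z, rhd τ (rhd ω x y) z = rhd ω (rhd τ x z) y)
    {T U : Module.End k N} (hT : T ∈ rightMulAlgebra rhd) (hU : U ∈ rightMulAlgebra rhd) (x : N) :
    T (U x) = U (T x) := by
  induction hU using Algebra.adjoin_induction generalizing x with
  | mem U hU =>
    obtain ⟨⟨τ, z⟩, rfl⟩ := hU
    exact rightMulAlgebra_apply_rhd hN2 hT τ x z
  | algebraMap c => simp
  | add U V _ _ hU hV => simp [hU, hV]
  | mul U V _ _ hU hV => simp [hU, hV]

theorem rightMulAlgebra_symm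
    (hN1 : ∀ ω τ x y z, rhd τ (rhd ω x y) z - rhd ω x (rhd τ y z)
      = rhd τ (rhd ω y x) z - rhd ω y (rhd τ x z))
    (hN2 : ∀ ω τ x y z, rhd τ (rhd ω x y) z = rhd ω (rhd τ x z) y)
    {T : Module.End k N} (hT : T ∈ rightMulAlgebra rhd) (ω : Ω) (x y : N) :
    rhd ω x (T y) - T (rhd ω x y) = rhd ω y (T x) - T (rhd ω y x) := by
  induction hT using Algebra.adjoin_induction generalizing x y with
  | mem T hT =>
    obtain ⟨⟨τ, z⟩, rfl⟩ := hT
    rw [← neg_sub, ← neg_sub (((rhd τ).flip z) (rhd ω y x))]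
    exact congrArg _ (hN1 ω τ x y z)
  | algebraMap c => simp
  | add T U _ _ hT hU =>
    have := congrArg₂ (· + ·) (hT x y) (hU x y)
    simp only [LinearMap.add_apply, map_add] at this ⊢
    rw [add_sub_add_comm, this, add_sub_add_comm]
  | mul T U hT' hU' hT hU =>
    have key : ∀ x y, rhd ω x (T (U y)) - T (rhd ω x (U y))
        = U (rhd ω x (T y) - T (rhd ω x y)) := fun x y => by
      rw [hT x (U y), hT x y, map_sub, rightMulAlgebra_apply_rhd hN2 hU' ω y (T x),
        ← rightMulAlgebra_apply_rhd hN2 hU' ω y x, rightMulAlgebra_comm hN2 hT' hU']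
    simp only [Module.End.mul_apply]
    rw [← sub_add_sub_cancel _ (T (rhd ω x (U y))), key, ← map_sub, hT, hU, map_sub T, ← key,
      sub_add_sub_cancel]

/-- `rightMulAlgebra` is commutative by right commutativity of the products. -/
abbrev rightMulCommRing
    (hN2 : ∀ ω τ x y z, rhd τ (rhd ω x y) z = rhd ω (rhd τ x z) y) :
    CommRing (rightMulAlgebra rhd) :=
  { (rightMulAlgebra rhd).toRing with
    mul_comm := fun T U => Subtype.ext (LinearMap.ext (rightMulAlgebra_comm hN2 T.2 U.2)) }

end RightMultiplications

theorem exists_linearMap {k : Type*} [Field k] {Ω X N : Type*} [AddCommGroup N] [Module k N]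
    (rhd : Ω → N →ₗ[k] N →ₗ[k] N)
    (hN1 : ∀ ω τ x y z, rhd τ (rhd ω x y) z - rhd ω x (rhd τ y z)
      = rhd τ (rhd ω y x) z - rhd ω y (rhd τ x z))
    (hN2 : ∀ ω τ x y z, rhd τ (rhd ω x y) z = rhd ω (rhd τ x z) y) (f : X → N) :
    ∃ L : MvPolynomial (FreeMonoid Ω × X) k →ₗ[k] N, (∀ x, L (MvPolynomial.X (1, x)) = f x) ∧
      ∀ ω, ∀ a ∈ novikovSubmodule k Ω X, ∀ b ∈ novikovSubmodule k Ω X,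
        L (a * novikovDeriv k ω b) = rhd ω (L a) (L b) := by
  let _ := rightMulCommRing hN2
  let R : Ω → N → rightMulAlgebra rhd := fun ω y =>
    ⟨(rhd ω).flip y, Algebra.subset_adjoin ⟨(ω, y), rfl⟩⟩
  have hsmul : ∀ (T : rightMulAlgebra rhd) (x : N), T • x = (T : Module.End k N) x :=
    fun _ _ => rfl
  have : FaithfulSMul (rightMulAlgebra rhd) N :=
    ⟨fun h => Subtype.ext (LinearMap.ext h)⟩
  refine exists_linearMap_of_isSymmetric (R := R) (fun ω T x y => ?_) f rhd fun _ _ _ => rfl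
  rw [mul_comm, mul_comm _ T, sub_smul, sub_smul, mul_smul, mul_smul]
  exact rightMulAlgebra_symm hN1 hN2 T.2 ω x y

end MultiNovikov

/-- The smallest `k`-submodule `P` of `k[W(Ω) × X]` containing the generators
`X_{(1,x)}` and closed under the operations `a ∗_ω b := a · D_ω(b)` is, with these operations,
the free noncommuting multi-Novikov algebra on `X`. -/
theorem novikovSubmodule_free_noncommuting_multiNovikov
    (k : Type*) [Field k] (Ω X : Type*)
    (N : Type*) [AddCommGroup N] [Module k N]
    (rhd : Ω → N →ₗ[k] N →ₗ[k] N)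
    (hN1 : ∀ (ω τ : Ω) (x y z : N),
      rhd τ (rhd ω x y) z - rhd ω x (rhd τ y z)
        = rhd τ (rhd ω y x) z - rhd ω y (rhd τ x z))
    (hN2 : ∀ (ω τ : Ω) (x y z : N),
      rhd τ (rhd ω x y) z = rhd ω (rhd τ x z) y)
    (f : X → N) :
    ∃! F : novikovSubmodule k Ω X →ₗ[k] N,
      (∀ x : X, F ⟨MvPolynomial.X (1, x), X_mem_novikovSubmodule k Ω X x⟩ = f x) ∧
      (∀ (ω : Ω) (a b : MvPolynomial (FreeMonoid Ω × X) k)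
          (ha : a ∈ novikovSubmodule k Ω X) (hb : b ∈ novikovSubmodule k Ω X)
          (hab : a * novikovDeriv k ω b ∈ novikovSubmodule k Ω X),
          F ⟨a * novikovDeriv k ω b, hab⟩ = rhd ω (F ⟨a, ha⟩) (F ⟨b, hb⟩)) := by

  obtain ⟨L, hLX, hL⟩ := MultiNovikov.exists_linearMap rhd hN1 hN2 f
  refine ⟨L.domRestrict _, ⟨hLX, fun ω a b ha hb _ => hL ω a ha b hb⟩, fun F hF => ?_⟩
  have hle : novikovSubmodule k Ω X
      ≤ (LinearMap.ker (F - L.domRestrict _)).map (novikovSubmodule k Ω X).subtype := by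
    refine sInf_le ⟨fun x => ?_, fun ω a b ha hb => ?_⟩
    · refine ⟨⟨_, X_mem_novikovSubmodule k Ω X x⟩, ?_, rfl⟩
      simp [hF.1, hLX]
    · obtain ⟨a, ha, rfl⟩ := ha
      obtain ⟨b, hb, rfl⟩ := hb
      have hab : a.1 * novikovDeriv k ω b.1 ∈ novikovSubmodule k Ω X :=
        Submodule.mem_sInf.2 fun M hM => hM.2 ω _ _ (Submodule.mem_sInf.1 a.2 M hM)
          (Submodule.mem_sInf.1 b.2 M hM)
      have ha' : F a = L a := by simpa [sub_eq_zero] using ha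
      have hb' : F b = L b := by simpa [sub_eq_zero] using hb
      refine ⟨⟨_, hab⟩, ?_, rfl⟩
      simp [hF.2 ω a b a.2 b.2 hab, hL ω a a.2 b b.2, ha', hb']
  ext p
  obtain ⟨q, hq, hqp⟩ := hle p.2
  obtain rfl : q = p := Subtype.ext hqp
  simpa [sub_eq_zero] using hq
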